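/- There exists ε₀ > 0, depending only on S and k, such that for every k-fission H of S within any ε ≤ ε₀: H is a plain k-fission of S if and only if the number of halving edges of H equals k times the number of halving edges of S. -/

import Mathlib

noncomputable section

/-- The plane. -/
abbrev Pt : Type := EuclideanSpace ℝ (Fin 2)

/-- Signed determinant of the triple `(p, q, r)`: positive iff `r` lies on the left of
the directed line from `p` to `q`. -/
def det2 (p q r : Pt) : ℝ :=
  (q 0 - p 0) * (r 1 - p 1) - (q 1 - p 1) * (r 0 - p 0)

/-- A finite set of points in the plane is in general position if no three of its
(distinct) points are collinear. -/
def GenPos (S : Finset Pt) : Prop :=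
  ∀ p ∈ S, ∀ q ∈ S, ∀ r ∈ S, p ≠ q → p ≠ r → q ≠ r →
    ¬ Collinear ℝ ({p, q, r} : Set Pt)

/-- `{p, q}` is a halving edge of `S`: `p, q` are distinct points of `S` and the open
half-planes on the two sides of the line through `p` and `q` each contain exactly
`(|S| - 2)/2` points of `S`. -/
def HalvingEdge (S : Finset Pt) (p q : Pt) : Prop :=
  p ∈ S ∧ q ∈ S ∧ p ≠ q ∧
    {r ∈ (S : Set Pt) | 0 < det2 p q r}.ncard = (S.card - 2) / 2 ∧
    {r ∈ (S : Set Pt) | det2 p q r < 0}.ncard = (S.card - 2) / 2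

/-- The halving edges graph of `S` (as a graph on the whole plane; all vertices
outside `S` are isolated). -/
def halvingGraph (S : Finset Pt) : SimpleGraph Pt :=
  SimpleGraph.fromRel (HalvingEdge S)

/-- The number of halving edges of `S`. -/
def halvingEdgeCount (S : Finset Pt) : ℕ :=
  {e : Sym2 Pt | ∃ p q, e = s(p, q) ∧ HalvingEdge S p q}.ncard

/-- `H`, together with the cluster map `cl`, is a `k`-fission of `S` within `ε`:
`H` is a set of `k * |S|` points in general position partitioned into clusters
`cl v` of `k` points, one for each `v ∈ S`, with each point of the `v`-cluster
within distance `ε` of `v`. -/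
structure IsFission (S : Finset Pt) (k : ℕ) (ε : ℝ) (H : Finset Pt)
    (cl : Pt → Finset Pt) : Prop where
  genPos : GenPos H
  cluster_card : ∀ v ∈ S, (cl v).card = k
  disj : ∀ v ∈ S, ∀ w ∈ S, v ≠ w → Disjoint (cl v) (cl w)
  union_eq : (H : Set Pt) = ⋃ v ∈ S, (cl v : Set Pt)
  close : ∀ v ∈ S, ∀ x ∈ cl v, dist x v ≤ ε

/-- A fission is plain if no halving edge of `H` has both endpoints in the same cluster. -/
def IsPlain (S : Finset Pt) (H : Finset Pt) (cl : Pt → Finset Pt) : Prop :=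
  ∀ v ∈ S, ∀ p ∈ cl v, ∀ q ∈ cl v, ¬ HalvingEdge H p q


local instance : DecidableEq Pt := Classical.decEq _

lemma walk_crossing_sum {ι : Type*} [DecidableEq ι] (σ : ι → ℝ) (ρ : ι → Prop)
    [DecidablePred ρ] (s : Finset ι) : Set.InjOn σ s → ∀ m : ℤ,
    ∑ i ∈ s, (if ((s.filter fun j => if ρ j then σ i < σ j else σ j < σ i).card : ℤ) = m
        then (if ρ i then (1 : ℤ) else -1) else 0) =
      (if ((s.filter fun j => ¬ ρ j).card : ℤ) ≤ m then 1 else 0) -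
        (if ((s.filter ρ).card : ℤ) ≤ m then 1 else 0) := by
  induction s using Finset.induction_on_max_value σ with
  | empty => intro _ m; simp
  | insert a s ha hmax ih =>
    intro hinj m
    have hlt : ∀ x ∈ s, σ x < σ a := fun x hx => lt_of_le_of_ne (hmax x hx) fun h => ha <| by
      have := hinj (by simp [hx]) (by simp) h
      exact this ▸ hx
    have hs : Set.InjOn σ s := hinj.mono (by simp)
    rw [Finset.sum_insert ha]
    have hga : ((insert a s).filter fun j => if ρ j then σ a < σ j else σ j < σ a) =
        s.filter fun j => ¬ ρ j := by
      ext j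
      simp only [Finset.mem_filter, Finset.mem_insert]
      constructor
      · rintro ⟨rfl | hj, h⟩
        · split_ifs at h <;> exact absurd h (lt_irrefl _)
        · refine ⟨hj, fun hr => ?_⟩
          rw [if_pos hr] at h
          exact absurd h (hlt j hj).not_gt
      · rintro ⟨hj, h⟩
        exact ⟨Or.inr hj, by rw [if_neg h]; exact hlt j hj⟩
    rw [hga]
    by_cases hr : ρ a
    · have hg : ∀ i ∈ s, (((insert a s).filter
          fun j => if ρ j then σ i < σ j else σ j < σ i).card : ℤ) =
          (s.filter fun j => if ρ j then σ i < σ j else σ j < σ i).card + 1 := by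
        intro i hi
        rw [Finset.filter_insert, if_pos (by rw [if_pos hr]; exact hlt i hi),
          Finset.card_insert_of_notMem (by simp [ha])]
        push_cast; rfl
      have := ih hs (m - 1)
      rw [Finset.sum_congr rfl fun i hi => by rw [hg i hi]]
      simp only [← eq_sub_iff_add_eq]
      rw [this, if_pos hr, Finset.filter_insert, if_neg (not_not.2 hr), Finset.filter_insert,
        if_pos hr, Finset.card_insert_of_notMem (by simp [ha])]
      push_cast
      split_ifs <;> omega
    · have hg : ∀ i ∈ s, ((insert a s).filter
          fun j => if ρ j then σ i < σ j else σ j < σ i) =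
          (s.filter fun j => if ρ j then σ i < σ j else σ j < σ i) := by
        intro i hi
        rw [Finset.filter_insert, if_neg (by rw [if_neg hr]; exact (hlt i hi).not_gt)]
      have := ih hs m
      rw [Finset.sum_congr rfl fun i hi => by rw [hg i hi]]
      rw [this, Finset.filter_insert, if_pos hr, Finset.filter_insert, if_neg hr,
        Finset.card_insert_of_notMem (by simp [ha])]
      push_cast
      simp only [if_neg hr]
      split_ifs <;> omega

lemma det2_swap (p q r : Pt) : det2 q p r = - det2 p q r := by
  unfold det2; ring

lemma det2_self_left (p q : Pt) : det2 p q p = 0 := by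
  unfold det2; ring

lemma det2_self_right (p q : Pt) : det2 p q q = 0 := by
  unfold det2; ring

lemma collinear_of_det2_eq_zero {p q r : Pt} (hpq : p ≠ q) (h : det2 p q r = 0) :
    Collinear ℝ ({p, q, r} : Set Pt) := by
  have hne : (q 0 - p 0) ^ 2 + (q 1 - p 1) ^ 2 ≠ 0 := by
    intro h0
    apply hpq
    ext i
    fin_cases i
    · simp only [Fin.zero_eta]; nlinarith [sq_nonneg (q 0 - p 0), sq_nonneg (q 1 - p 1)]
    · simp only [Fin.mk_one]; nlinarith [sq_nonneg (q 0 - p 0), sq_nonneg (q 1 - p 1)]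
  rw [collinear_iff_of_mem (p₀ := p) (by simp)]
  refine ⟨q - p, ?_⟩
  simp only [Set.mem_insert_iff, Set.mem_singleton_iff, forall_eq_or_imp, forall_eq]
  refine ⟨⟨0, by simp⟩, ⟨1, by simp⟩,
    ⟨((r 0 - p 0) * (q 0 - p 0) + (r 1 - p 1) * (q 1 - p 1)) /
      ((q 0 - p 0) ^ 2 + (q 1 - p 1) ^ 2), ?_⟩⟩
  unfold det2 at h
  ext i
  fin_cases i
  · simp only [Fin.zero_eta, vadd_eq_add, PiLp.add_apply, PiLp.smul_apply, PiLp.sub_apply,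
      smul_eq_mul]
    field_simp
    linear_combination (q 1 - p 1) * h * (-1)
  · simp only [Fin.mk_one, vadd_eq_add, PiLp.add_apply, PiLp.smul_apply, PiLp.sub_apply,
      smul_eq_mul]
    field_simp
    linear_combination (q 0 - p 0) * h

lemma GenPos.det2_ne_zero {S : Finset Pt} (hS : GenPos S) {p q r : Pt} (hp : p ∈ S) (hq : q ∈ S)
    (hr : r ∈ S) (hpq : p ≠ q) (hpr : p ≠ r) (hqr : q ≠ r) : det2 p q r ≠ 0 :=
  fun h => hS p hp q hq r hr hpq hpr hqr (collinear_of_det2_eq_zero hpq h)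

lemma GenPos.mono {S T : Finset Pt} (hT : GenPos T) (h : S ⊆ T) : GenPos S :=
  fun p hp q hq r hr => hT p (h hp) q (h hq) r (h hr)

/-- The number of points of `C` strictly to the left of the directed line from `p` to `q`. -/
def leftCount (C : Finset Pt) (p q : Pt) : ℕ := (C.filter fun r => 0 < det2 p q r).card

lemma leftCount_swap (C : Finset Pt) (p q : Pt) :
    leftCount C q p = (C.filter fun r => det2 p q r < 0).card := by
  simp [leftCount, det2_swap p q]

lemma leftCount_add_leftCount {C : Finset Pt} (hC : GenPos C) {p q : Pt} (hp : p ∈ C)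
    (hq : q ∈ C) (hpq : p ≠ q) : leftCount C p q + leftCount C q p + 2 = C.card := by
  have hzero : (C.filter fun r => ¬ 0 < det2 p q r).filter (fun r => ¬ det2 p q r < 0) =
      {p, q} := by
    ext r
    simp only [Finset.mem_filter, Finset.mem_insert, Finset.mem_singleton]
    constructor
    · rintro ⟨⟨hr, h1⟩, h2⟩
      by_contra! h
      exact hC.det2_ne_zero hp hq hr hpq h.1.symm h.2.symm (le_antisymm (not_lt.1 h1) (not_lt.1 h2))
    · rintro (rfl | rfl)
      · simp [hp, det2_self_left]
      · simp [hq, det2_self_right]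
  have hneg : (C.filter fun r => ¬ 0 < det2 p q r).filter (fun r => det2 p q r < 0) =
      C.filter fun r => det2 p q r < 0 := by
    ext r
    simp only [Finset.mem_filter]
    exact ⟨fun h => ⟨h.1.1, h.2⟩, fun h => ⟨⟨h.1, h.2.not_gt⟩, h.2⟩⟩
  have h1 := Finset.card_filter_add_card_filter_not (s := C) (fun r => 0 < det2 p q r)
  have h2 := Finset.card_filter_add_card_filter_not
    (s := C.filter fun r => ¬ 0 < det2 p q r) (fun r => det2 p q r < 0)
  rw [hzero, hneg, Finset.card_pair hpq] at h2
  rw [leftCount_swap C p q, leftCount]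
  omega

lemma halvingEdge_iff {S : Finset Pt} {p q : Pt} : HalvingEdge S p q ↔ p ∈ S ∧ q ∈ S ∧ p ≠ q ∧
    leftCount S p q = (S.card - 2) / 2 ∧ leftCount S q p = (S.card - 2) / 2 := by
  have h : ∀ P : Pt → Prop, ∀ _ : DecidablePred P,
      {r ∈ (S : Set Pt) | P r}.ncard = (S.filter P).card := by
    intro P _
    rw [← Set.ncard_coe_finset]
    simp
  unfold HalvingEdge
  rw [leftCount_swap S p q, leftCount, h _ inferInstance, h _ inferInstance]

lemma HalvingEdge.symm {S : Finset Pt} {p q : Pt} (h : HalvingEdge S p q) : HalvingEdge S q p := by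
  rw [halvingEdge_iff] at *
  exact ⟨h.2.1, h.1, h.2.2.1.symm, h.2.2.2.2, h.2.2.2.1⟩

/-- `1` if `q` lies beyond `p` in the direction `ℓ` and the line `pq` splits the rest of `C`
evenly, `-1` if it lies before `p` and the line splits evenly, and `0` otherwise. -/
def edgeSign (C : Finset Pt) (ℓ : Pt → ℝ) (p q : Pt) : ℤ :=
  if leftCount C p q = leftCount C q p then
    (if ℓ p < ℓ q then 1 else if ℓ q < ℓ p then -1 else 0) else 0

lemma edgeSign_swap (C : Finset Pt) (ℓ : Pt → ℝ) (p q : Pt) :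
    edgeSign C ℓ q p = - edgeSign C ℓ p q := by
  unfold edgeSign
  rcases lt_trichotomy (ℓ p) (ℓ q) with h | h | h
  · rw [if_neg h.not_gt, if_pos h, if_pos h]
    split_ifs <;> omega
  · simp [h]
  · rw [if_pos h, if_neg h.not_gt, if_pos h]
    split_ifs <;> omega

lemma sum_edgeSign_eq_one {C : Finset Pt} (hC : GenPos C) {k : ℕ} (hk : C.card = 2 * k)
    (a b : ℝ) (ℓ : Pt → ℝ) (hℓ : ∀ r, ℓ r = a * r 0 + b * r 1) {p : Pt} (hp : p ∈ C)
    (hL : (C.filter fun r => ℓ r ≤ ℓ p).card ≤ k) : ∑ q ∈ C, edgeSign C ℓ p q = 1 := by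
  set X : Pt → ℝ := fun r => ℓ r - ℓ p with hX
  set Y : Pt → ℝ := fun r => a * (r 1 - p 1) - b * (r 0 - p 0) with hY
  set σ : Pt → ℝ := fun r => Y r / X r with hσ
  have hdet : ∀ q r, (a ^ 2 + b ^ 2) * det2 p q r = X q * Y r - Y q * X r := by
    intro q r; simp only [hX, hY, hℓ, det2]; ring
  have hab : ∀ q, X q ≠ 0 → 0 < a ^ 2 + b ^ 2 := by
    intro q hq
    rcases (add_nonneg (sq_nonneg a) (sq_nonneg b)).lt_or_eq with h | h
    · exact h
    · exfalso
      have ha : a = 0 := by nlinarith [sq_nonneg a, sq_nonneg b]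
      have hb : b = 0 := by nlinarith [sq_nonneg a, sq_nonneg b]
      exact hq (by simp [hX, hℓ, ha, hb])
  have hne : ∀ q, X q ≠ 0 → p ≠ q := by
    rintro q hq rfl
    exact hq (by simp [hX])
  have hdet' : ∀ q r, X q ≠ 0 → (a ^ 2 + b ^ 2) * det2 p q r = X q * (Y r - σ q * X r) := by
    intro q r hq
    rw [hdet, hσ]; field_simp
  set s := C.filter fun r => X r ≠ 0 with hs
  have hinj : Set.InjOn σ s := by
    intro q hq r hr h
    simp only [hs, Finset.coe_filter, Set.mem_ofPred_eq] at hq hr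
    by_contra hqr
    refine hC.det2_ne_zero hp hq.1 hr.1 (hne q hq.2) (hne r hr.2) hqr ?_
    have h1 := hdet' q r hq.2
    have h2 : Y r = σ r * X r := by simp only [hσ]; field_simp [hr.2]
    rw [h, h2, sub_self, mul_zero] at h1
    exact (mul_eq_zero.1 h1).resolve_left (hab q hq.2).ne'
  have hwalk := walk_crossing_sum σ (fun r => 0 < X r) s hinj
  set c : ℕ := (C.filter fun r => X r = 0 ∧ 0 < Y r).card with hc
  have habove : ∀ q ∈ s, (C.filter fun r => 0 < Y r - σ q * X r).card =
      (s.filter fun r => if 0 < X r then σ q < σ r else σ r < σ q).card + c := by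
    intro q hq
    rw [hc, ← Finset.card_filter_add_card_filter_not (s := C.filter fun r => 0 < Y r - σ q * X r)
      (fun r => X r ≠ 0)]
    congr 2
    · ext r
      simp only [hs, Finset.mem_filter, and_assoc]
      refine and_congr_right fun _ => ?_
      rw [and_comm]
      refine and_congr_right fun hr => ?_
      have h2 : Y r = σ r * X r := by simp only [hσ]; field_simp [hr]
      rw [h2, ← sub_mul]
      split_ifs with h
      · rw [mul_pos_iff_of_pos_right h, sub_pos]
      · rw [← neg_mul_neg, mul_pos_iff_of_pos_right (neg_pos.2 (lt_of_le_of_ne (not_lt.1 h) hr)),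
          neg_sub, sub_pos]
    · ext r
      simp only [Finset.mem_filter, and_assoc, not_not]
      refine and_congr_right fun _ => ?_
      constructor
      · rintro ⟨h1, h2⟩; rw [h2] at h1; exact ⟨h2, by simpa using h1⟩
      · rintro ⟨h1, h2⟩; rw [h1]; exact ⟨by simpa using h2, rfl⟩
  have hterm : ∀ q ∈ s, edgeSign C ℓ p q =
      if ((s.filter fun r => if 0 < X r then σ q < σ r else σ r < σ q).card : ℤ) =
        (k : ℤ) - 1 - c then (if 0 < X q then (1 : ℤ) else -1) else 0 := by
    intro q hq
    have h1 := habove q hq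
    obtain ⟨hqC, hq0⟩ := Finset.mem_filter.1 hq
    have h2 := leftCount_add_leftCount hC hp hqC (hne q hq0)
    have hpos := hab q hq0
    rcases lt_or_gt_of_ne hq0 with hq0' | hq0'
    · have h3 : leftCount C q p = (C.filter fun r => 0 < Y r - σ q * X r).card := by
        rw [leftCount_swap]
        congr 1
        refine Finset.filter_congr fun r _ => ?_
        rw [← neg_pos, ← mul_pos_iff_of_pos_left hpos, mul_neg, hdet' q r hq0, ← neg_mul,
          mul_pos_iff_of_pos_left (neg_pos.2 hq0')]
      have h4 : ℓ q < ℓ p := sub_neg.1 hq0'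
      rw [edgeSign, if_neg h4.not_gt, if_pos h4, if_neg hq0'.not_gt]
      refine if_congr ?_ rfl rfl
      omega
    · have h3 : leftCount C p q = (C.filter fun r => 0 < Y r - σ q * X r).card := by
        rw [leftCount]
        congr 1
        refine Finset.filter_congr fun r _ => ?_
        rw [← mul_pos_iff_of_pos_left hpos, hdet' q r hq0, mul_pos_iff_of_pos_left hq0']
      have h4 : ℓ p < ℓ q := sub_pos.1 hq0'
      rw [edgeSign, if_pos h4, if_pos hq0']
      refine if_congr ?_ rfl rfl
      omega
  have hsub : ∑ q ∈ C, edgeSign C ℓ p q = ∑ q ∈ s, edgeSign C ℓ p q := by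
    refine (Finset.sum_subset (Finset.filter_subset _ _) fun q hq hqs => ?_).symm
    have h0 : X q = 0 := by
      by_contra h
      exact hqs (Finset.mem_filter.2 ⟨hq, h⟩)
    have h1 : ℓ q = ℓ p := sub_eq_zero.1 h0
    simp [edgeSign, h1]
  rw [hsub, Finset.sum_congr rfl hterm, hwalk]
  have hle : (s.filter fun r => ¬ 0 < X r).card + c + 1 ≤ k := by
    refine le_trans ?_ hL
    rw [hc, ← Finset.card_union_of_disjoint, ← Finset.card_insert_of_notMem (a := p)]
    · refine Finset.card_le_card fun r hr => ?_
      simp only [hs, Finset.mem_insert, Finset.mem_union, Finset.mem_filter, not_lt] at hr ⊢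
      rcases hr with rfl | ⟨⟨hr, -⟩, h⟩ | ⟨hr, h, -⟩
      · exact ⟨hp, le_rfl⟩
      · exact ⟨hr, sub_nonpos.1 h⟩
      · exact ⟨hr, (sub_eq_zero.1 h).le⟩
    · simp [hs, hX, hY]
    · rw [Finset.disjoint_left]
      intro r hr hr'
      simp only [hs, Finset.mem_filter] at hr hr'
      exact hr.1.2 hr'.2.1
  have hgt : k ≤ (s.filter fun r => 0 < X r).card := by
    have h1 := Finset.card_filter_add_card_filter_not (s := C) (fun r => ℓ r ≤ ℓ p)
    have h2 : (s.filter fun r => 0 < X r) = C.filter fun r => ¬ ℓ r ≤ ℓ p := by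
      ext r
      simp only [hs, Finset.mem_filter, and_assoc, not_le, hX, sub_pos]
      exact and_congr_right fun _ => ⟨fun h => h.2, fun h => ⟨(sub_pos.2 h).ne', h⟩⟩
    rw [h2]
    omega
  rw [if_pos (by omega), if_neg (by omega)]
  rfl

/-- Exactly `k` pairs of points, one from each of two linearly separated sets of `k` points,
span a line that splits the remaining points evenly. -/
lemma card_crossing_eq {A B : Finset Pt} (hAB : GenPos (A ∪ B)) {k : ℕ} (hA : A.card = k)
    (hB : B.card = k) (a b : ℝ)
    (hsep : ∀ p ∈ A, ∀ q ∈ B, a * p 0 + b * p 1 < a * q 0 + b * q 1) :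
    ((A ×ˢ B).filter fun e =>
      leftCount (A ∪ B) e.1 e.2 = leftCount (A ∪ B) e.2 e.1).card = k := by
  set ℓ : Pt → ℝ := fun r => a * r 0 + b * r 1 with hℓ
  have hdisj : Disjoint A B := Finset.disjoint_left.2 fun p hp hq => lt_irrefl _ (hsep p hp p hq)
  have hcard : (A ∪ B).card = 2 * k := by rw [Finset.card_union_of_disjoint hdisj]; omega
  have h1 : ∀ p ∈ A, ∑ q ∈ A ∪ B, edgeSign (A ∪ B) ℓ p q = 1 := by
    intro p hp
    refine sum_edgeSign_eq_one hAB hcard a b ℓ (fun _ => rfl) (Finset.mem_union_left _ hp) ?_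
    rw [← hA]
    refine Finset.card_le_card fun r hr => ?_
    obtain ⟨hr, hle⟩ := Finset.mem_filter.1 hr
    exact (Finset.mem_union.1 hr).resolve_right fun h => (hsep p hp r h).not_ge hle
  have h2 : ∑ p ∈ A, ∑ q ∈ A, edgeSign (A ∪ B) ℓ p q = 0 := by
    have h := Finset.sum_comm (s := A) (t := A) (f := fun p q => edgeSign (A ∪ B) ℓ p q)
    rw [Finset.sum_congr rfl fun q _ => Finset.sum_congr rfl fun p _ =>
      edgeSign_swap (A ∪ B) ℓ q p] at h
    simp only [Finset.sum_neg_distrib] at h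
    omega
  have h3 : ∑ p ∈ A, ∑ q ∈ B, edgeSign (A ∪ B) ℓ p q = k := by
    have h := Finset.sum_congr rfl h1
    simp only [Finset.sum_union hdisj, Finset.sum_add_distrib, h2] at h
    simpa [hA] using h
  rw [← Nat.cast_inj (R := ℤ), ← h3, Finset.card_filter, ← Finset.sum_product', Nat.cast_sum]
  refine Finset.sum_congr rfl fun e he => ?_
  obtain ⟨he1, he2⟩ := Finset.mem_product.1 he
  rw [edgeSign, if_pos (hsep _ he1 _ he2)]
  split_ifs <;> rfl

open Classical in
/-- The ordered pairs of points spanning a halving edge of `S`. -/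
def halvingPairs (S : Finset Pt) : Finset (Pt × Pt) :=
  (S ×ˢ S).filter fun e => HalvingEdge S e.1 e.2

lemma card_halvingPairs (S : Finset Pt) : (halvingPairs S).card = 2 * halvingEdgeCount S := by
  have hmem : ∀ p q, (p, q) ∈ halvingPairs S ↔ HalvingEdge S p q := fun p q => by
    simp only [halvingPairs, Finset.mem_filter, Finset.mem_product]
    exact ⟨fun h => h.2, fun h => ⟨⟨h.1, h.2.1⟩, h⟩⟩
  have himage : {e : Sym2 Pt | ∃ p q, e = s(p, q) ∧ HalvingEdge S p q} =
      ((halvingPairs S).image fun e => s(e.1, e.2) : Finset (Sym2 Pt)) := by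
    ext e
    simp only [Finset.coe_image, Set.mem_image, Finset.mem_coe, Prod.exists, hmem]
    exact ⟨fun ⟨p, q, h1, h2⟩ => ⟨p, q, h2, h1.symm⟩, fun ⟨p, q, h1, h2⟩ => ⟨p, q, h2.symm, h1⟩⟩
  rw [halvingEdgeCount, himage, Set.ncard_coe_finset,
    Finset.card_eq_sum_card_image (fun e : Pt × Pt => s(e.1, e.2)), mul_comm, ← smul_eq_mul]
  refine Finset.sum_const_nat fun e he => ?_
  obtain ⟨⟨p, q⟩, hpq, rfl⟩ := Finset.mem_image.1 he
  have hE := (hmem p q).1 hpq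
  have hfib : ((halvingPairs S).filter fun a => s(a.1, a.2) = s(p, q)) = {(p, q), (q, p)} := by
    ext ⟨a, b⟩
    simp only [Finset.mem_filter, hmem, Sym2.eq_iff, Finset.mem_insert, Finset.mem_singleton,
      Prod.mk.injEq]
    refine ⟨fun h => h.2, fun h => ⟨?_, h⟩⟩
    rcases h with ⟨rfl, rfl⟩ | ⟨rfl, rfl⟩
    · exact hE
    · exact hE.symm
  exact (congrArg Finset.card hfib).trans
    (Finset.card_pair fun h => hE.2.2.1 (Prod.mk.inj h).1)

lemma continuous_det2 : Continuous fun x : Pt × Pt × Pt => det2 x.1 x.2.1 x.2.2 := by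
  unfold det2; fun_prop

lemma eventually_forall_dist_le {E : Type*} [PseudoMetricSpace E] {x₀ : E} {P : E → Prop}
    (h : ∀ᶠ x in nhds x₀, P x) : ∀ᶠ δ in nhdsWithin (0 : ℝ) (Set.Ioi 0), ∀ x, dist x x₀ ≤ δ → P x := by
  obtain ⟨ε, hε, hP⟩ := Metric.eventually_nhds_iff.1 h
  filter_upwards [Ioo_mem_nhdsGT hε] with δ hδ x hx
  exact hP (hx.trans_lt hδ.2)

/-- Small perturbations of a set in general position preserve all orientations, and keep
perturbed points separated in the direction joining the original ones. -/
lemma exists_stable_radius {S : Finset Pt} (hS : GenPos S) : ∃ δ > 0,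
    (∀ v ∈ S, ∀ w ∈ S, ∀ z ∈ S, v ≠ w → v ≠ z → w ≠ z → ∀ p q r, dist p v ≤ δ → dist q w ≤ δ →
      dist r z ≤ δ → (0 < det2 p q r ↔ 0 < det2 v w z)) ∧
    (∀ v ∈ S, ∀ w ∈ S, v ≠ w → ∀ p q, dist p v ≤ δ → dist q w ≤ δ →
      (w 0 - v 0) * p 0 + (w 1 - v 1) * p 1 < (w 0 - v 0) * q 0 + (w 1 - v 1) * q 1) := by
  have h1 : ∀ᶠ δ in nhdsWithin (0 : ℝ) (Set.Ioi 0), ∀ v ∈ S, ∀ w ∈ S, ∀ z ∈ S,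
      v ≠ w → v ≠ z → w ≠ z → ∀ p q r, dist p v ≤ δ → dist q w ≤ δ →
      dist r z ≤ δ → (0 < det2 p q r ↔ 0 < det2 v w z) := by
    refine (Finset.eventually_all S).2 fun v hv => (Finset.eventually_all S).2 fun w hw =>
      (Finset.eventually_all S).2 fun z hz => ?_
    by_cases hd : v ≠ w ∧ v ≠ z ∧ w ≠ z
    · have hev : ∀ᶠ x : Pt × Pt × Pt in nhds (v, w, z),
          (0 < det2 x.1 x.2.1 x.2.2 ↔ 0 < det2 v w z) := by
        have hc := continuous_det2.continuousAt (x := (v, w, z))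
        rcases lt_or_gt_of_ne (hS.det2_ne_zero hv hw hz hd.1 hd.2.1 hd.2.2) with h | h
        · filter_upwards [hc.eventually_lt_const h] with x hx
          exact iff_of_false hx.not_gt h.not_gt
        · filter_upwards [hc.eventually_const_lt h] with x hx
          exact iff_of_true hx h
      filter_upwards [eventually_forall_dist_le hev] with δ hδ _ _ _ p q r hp hq hr
      exact hδ (p, q, r) (max_le hp (max_le hq hr))
    · exact Filter.Eventually.of_forall fun δ h h' h'' => absurd ⟨h, h', h''⟩ hd
  have h2 : ∀ᶠ δ in nhdsWithin (0 : ℝ) (Set.Ioi 0), ∀ v ∈ S, ∀ w ∈ S, v ≠ w →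
      ∀ p q, dist p v ≤ δ → dist q w ≤ δ →
      (w 0 - v 0) * p 0 + (w 1 - v 1) * p 1 < (w 0 - v 0) * q 0 + (w 1 - v 1) * q 1 := by
    refine (Finset.eventually_all S).2 fun v _ => (Finset.eventually_all S).2 fun w _ => ?_
    by_cases hd : v = w
    · exact Filter.Eventually.of_forall fun δ h => absurd hd h
    · have hev : ∀ᶠ x : Pt × Pt in nhds (v, w), (w 0 - v 0) * x.1 0 + (w 1 - v 1) * x.1 1 <
          (w 0 - v 0) * x.2 0 + (w 1 - v 1) * x.2 1 := by
        refine ContinuousAt.eventually_lt (by fun_prop) (by fun_prop) ?_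
        by_contra hle
        apply hd
        ext i
        fin_cases i
        · simp only [Fin.zero_eta]; nlinarith [sq_nonneg (w 0 - v 0), sq_nonneg (w 1 - v 1)]
        · simp only [Fin.mk_one]; nlinarith [sq_nonneg (w 0 - v 0), sq_nonneg (w 1 - v 1)]
      filter_upwards [eventually_forall_dist_le hev] with δ hδ _ p q hp hq
      exact hδ (p, q) (max_le hp hq)
  obtain ⟨δ, ⟨ha, hb⟩, hδ⟩ := ((h1.and h2).and self_mem_nhdsWithin).exists
  exact ⟨δ, hδ, ha, hb⟩

lemma IsFission.eq_biUnion {S H : Finset Pt} {k : ℕ} {ε : ℝ} {cl : Pt → Finset Pt}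
    (hF : IsFission S k ε H cl) : H = S.biUnion cl := by
  rw [← Finset.coe_inj, hF.union_eq, Finset.coe_biUnion]; rfl

lemma IsFission.card_eq {S H : Finset Pt} {k : ℕ} {ε : ℝ} {cl : Pt → Finset Pt}
    (hF : IsFission S k ε H cl) : H.card = S.card * k := by
  rw [hF.eq_biUnion, Finset.card_biUnion hF.disj]
  exact Finset.sum_const_nat hF.cluster_card

lemma IsFission.subset {S H : Finset Pt} {k : ℕ} {ε : ℝ} {cl : Pt → Finset Pt}
    (hF : IsFission S k ε H cl) {v : Pt} (hv : v ∈ S) : cl v ⊆ H := by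
  rw [hF.eq_biUnion]; exact Finset.subset_biUnion_of_mem cl hv

lemma sum_eq_add_add_sum_erase {S : Finset Pt} (f : Pt → ℕ) {v w : Pt} (hv : v ∈ S) (hw : w ∈ S)
    (hvw : v ≠ w) : ∑ z ∈ S, f z = f v + f w + ∑ z ∈ (S.erase v).erase w, f z := by
  rw [← Finset.add_sum_erase S f hv, ← Finset.add_sum_erase (S.erase v) f
    (Finset.mem_erase.2 ⟨hvw.symm, hw⟩), add_assoc]

lemma IsFission.leftCount_eq {S H : Finset Pt} {k : ℕ} {ε : ℝ} {cl : Pt → Finset Pt}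
    (hF : IsFission S k ε H cl) {v w : Pt} (hv : v ∈ S) (hw : w ∈ S) (hvw : v ≠ w) {p q : Pt}
    (hstable : ∀ z ∈ S, v ≠ z → w ≠ z → ∀ r ∈ cl z, (0 < det2 p q r ↔ 0 < det2 v w z)) :
    leftCount H p q = k * leftCount S v w + leftCount (cl v ∪ cl w) p q := by
  have h1 : leftCount H p q = ∑ z ∈ S, ((cl z).filter fun r => 0 < det2 p q r).card := by
    rw [leftCount, hF.eq_biUnion, Finset.filter_biUnion, Finset.card_biUnion]
    exact fun a ha b hb hab => Finset.disjoint_filter_filter (hF.disj a ha b hb hab)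
  have h2 : leftCount (cl v ∪ cl w) p q = ((cl v).filter fun r => 0 < det2 p q r).card +
      ((cl w).filter fun r => 0 < det2 p q r).card := by
    rw [leftCount, Finset.filter_union, Finset.card_union_of_disjoint]
    exact Finset.disjoint_filter_filter (hF.disj v hv w hw hvw)
  have h3 : leftCount S v w = ∑ z ∈ (S.erase v).erase w, if 0 < det2 v w z then 1 else 0 := by
    rw [leftCount, Finset.card_filter, sum_eq_add_add_sum_erase _ hv hw hvw]
    simp [det2_self_left, det2_self_right]
  rw [h1, h2, h3, sum_eq_add_add_sum_erase _ hv hw hvw, add_comm, Finset.mul_sum]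
  congr 1
  refine Finset.sum_congr rfl fun z hz => ?_
  simp only [Finset.mem_erase] at hz
  have hst := hstable z hz.2.2 hz.2.1.symm hz.1.symm
  split_ifs with h
  · rw [Finset.filter_true_of_mem fun r hr => (hst r hr).2 h, hF.cluster_card z hz.2.2, mul_one]
  · rw [Finset.filter_false_of_mem fun r hr h' => h ((hst r hr).1 h')]; simp

lemma balanced_iff {k a b m x y : ℕ} (hab : a + b + 2 = 2 * m) (hxy : x + y + 2 = 2 * k) :
    (k * a + x = (2 * m * k - 2) / 2 ∧ k * b + y = (2 * m * k - 2) / 2) ↔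
      (a = (2 * m - 2) / 2 ∧ b = (2 * m - 2) / 2) ∧ x = y := by
  have hm : k * a + k * b + 2 * k = 2 * m * k := by rw [← hab]; ring
  constructor
  · rintro ⟨h1, h2⟩
    rcases lt_trichotomy a b with h | h | h
    · have : k * (a + 2) ≤ k * b := Nat.mul_le_mul_left k (by omega)
      rw [mul_add] at this
      omega
    · subst h; omega
    · have : k * (b + 2) ≤ k * a := Nat.mul_le_mul_left k (by omega)
      rw [mul_add] at this
      omega
  · rintro ⟨⟨h1, h2⟩, h3⟩
    obtain rfl : a = b := by omega
    omega

open Classical in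
/-- Sufficiently close clusters of points `v ≠ w` are traversed by exactly `k` halving edges if
`vw` is a halving edge, and by none otherwise. -/
lemma IsFission.card_traversing {S H : Finset Pt} (hS : GenPos S) (hcard : Even S.card) {k : ℕ}
    {ε : ℝ} {cl : Pt → Finset Pt} (hF : IsFission S k ε H cl) {v w : Pt} (hv : v ∈ S)
    (hw : w ∈ S) (hvw : v ≠ w)
    (hstable : ∀ z ∈ S, v ≠ z → w ≠ z → ∀ p ∈ cl v, ∀ q ∈ cl w, ∀ r ∈ cl z,
      (0 < det2 p q r ↔ 0 < det2 v w z) ∧ (0 < det2 q p r ↔ 0 < det2 w v z))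
    (a b : ℝ) (hsep : ∀ p ∈ cl v, ∀ q ∈ cl w, a * p 0 + b * p 1 < a * q 0 + b * q 1) :
    ((cl v ×ˢ cl w).filter fun e => HalvingEdge H e.1 e.2).card =
      if HalvingEdge S v w then k else 0 := by
  have hG : GenPos (cl v ∪ cl w) :=
    hF.genPos.mono (Finset.union_subset (hF.subset hv) (hF.subset hw))
  have hdisj := hF.disj v hv w hw hvw
  obtain ⟨m, hm⟩ := hcard.exists_two_nsmul
  rw [smul_eq_mul] at hm
  have key : ∀ e ∈ cl v ×ˢ cl w, (HalvingEdge H e.1 e.2 ↔ HalvingEdge S v w ∧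
      leftCount (cl v ∪ cl w) e.1 e.2 = leftCount (cl v ∪ cl w) e.2 e.1) := by
    rintro ⟨p, q⟩ he
    obtain ⟨hp, hq⟩ := Finset.mem_product.1 he
    dsimp only at hp hq ⊢
    have hpq : p ≠ q := fun h => Finset.disjoint_left.1 hdisj hp (h ▸ hq)
    have h1 := leftCount_add_leftCount hS hv hw hvw
    have h2 := leftCount_add_leftCount hG (Finset.mem_union_left _ hp)
      (Finset.mem_union_right _ hq) hpq
    rw [Finset.card_union_of_disjoint hdisj, hF.cluster_card v hv, hF.cluster_card w hw,
      ← two_mul] at h2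
    rw [hm] at h1
    have h3 := hF.leftCount_eq hv hw hvw fun z hz h h' r hr => (hstable z hz h h' p hp q hq r hr).1
    have h4 := hF.leftCount_eq hw hv hvw.symm
      fun z hz h h' r hr => (hstable z hz h' h p hp q hq r hr).2
    rw [Finset.union_comm] at h4
    rw [halvingEdge_iff, halvingEdge_iff, h3, h4, hF.card_eq, hm, balanced_iff h1 h2]
    simp only [hF.subset hv hp, hF.subset hw hq, hv, hw, ne_eq, hpq, hvw, not_false_eq_true,
      true_and]
  rw [Finset.filter_congr key]
  split_ifs with h
  · simp only [h, true_and]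
    convert card_crossing_eq hG (hF.cluster_card v hv) (hF.cluster_card w hw) a b hsep
  · simp [h]

open Classical in
/-- The halving pairs of a fission, grouped by the clusters of their endpoints. -/
lemma IsFission.card_halvingPairs_eq {S H : Finset Pt} {k : ℕ} {ε : ℝ} {cl : Pt → Finset Pt}
    (hF : IsFission S k ε H cl)
    (htrav : ∀ v ∈ S, ∀ w ∈ S, v ≠ w →
      ((cl v ×ˢ cl w).filter fun e => HalvingEdge H e.1 e.2).card =
        if HalvingEdge S v w then k else 0) :
    (halvingPairs H).card =
      ∑ v ∈ S, ((cl v ×ˢ cl v).filter fun e => HalvingEdge H e.1 e.2).card +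
        k * (halvingPairs S).card := by
  have hsum : ∀ f : Pt → ℕ, ∑ p ∈ H, f p = ∑ v ∈ S, ∑ p ∈ cl v, f p := fun f => by
    rw [hF.eq_biUnion, Finset.sum_biUnion hF.disj]
  have h1 : (halvingPairs H).card = ∑ v ∈ S, ∑ w ∈ S,
      ((cl v ×ˢ cl w).filter fun e => HalvingEdge H e.1 e.2).card := by
    rw [halvingPairs, Finset.card_filter, Finset.sum_product, hsum]
    refine Finset.sum_congr rfl fun v _ => ?_
    simp only [Finset.card_filter, Finset.sum_product, hsum]
    exact Finset.sum_comm
  have h2 : ∀ v ∈ S, ∀ w ∈ S, ((cl v ×ˢ cl w).filter fun e => HalvingEdge H e.1 e.2).card =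
      (if v = w then ((cl v ×ˢ cl v).filter fun e => HalvingEdge H e.1 e.2).card else 0) +
        k * (if HalvingEdge S v w then 1 else 0) := by
    intro v hv w hw
    by_cases hvw : v = w
    · subst hvw
      rw [if_pos rfl, if_neg fun h => h.2.2.1 rfl, mul_zero, add_zero]
    · rw [htrav v hv w hw hvw, if_neg hvw, zero_add, mul_ite, mul_one, mul_zero]
  rw [h1, Finset.sum_congr rfl fun v hv => Finset.sum_congr rfl (h2 v hv)]
  simp only [Finset.sum_add_distrib, ← Finset.mul_sum]
  congr 1
  · refine Finset.sum_congr rfl fun v hv => ?_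
    rw [Finset.sum_ite_eq, if_pos hv]
  · rw [halvingPairs, Finset.card_filter, Finset.sum_product]

theorem stmt8 (S : Finset Pt) (hS : GenPos S) (hcard : Even S.card)
    (k : ℕ) (hk : 1 ≤ k) :
    ∃ ε₀ > 0, ∀ ε : ℝ, 0 < ε → ε ≤ ε₀ →
      ∀ (H : Finset Pt) (cl : Pt → Finset Pt), IsFission S k ε H cl →
        (IsPlain S H cl ↔ halvingEdgeCount H = k * halvingEdgeCount S) := by
  classical
  obtain ⟨δ, hδ, horient, hsep⟩ := exists_stable_radius hS
  refine ⟨δ, hδ, fun ε _ hεδ H cl hF => ?_⟩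
  have hclose : ∀ v ∈ S, ∀ x ∈ cl v, dist x v ≤ δ := fun v hv x hx =>
    (hF.close v hv x hx).trans hεδ
  have hpairs := hF.card_halvingPairs_eq fun v hv w hw hvw =>
    hF.card_traversing hS hcard hv hw hvw
      (fun z hz hvz hwz p hp q hq r hr =>
        ⟨horient v hv w hw z hz hvw hvz hwz p q r (hclose v hv p hp) (hclose w hw q hq)
          (hclose z hz r hr),
        horient w hw v hv z hz hvw.symm hwz hvz q p r (hclose w hw q hq) (hclose v hv p hp)
          (hclose z hz r hr)⟩)
      (w 0 - v 0) (w 1 - v 1)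
      (fun p hp q hq => hsep v hv w hw hvw p q (hclose v hv p hp) (hclose w hw q hq))
  rw [card_halvingPairs, card_halvingPairs, mul_left_comm] at hpairs
  have hplain : IsPlain S H cl ↔
      ∑ v ∈ S, ((cl v ×ˢ cl v).filter fun e => HalvingEdge H e.1 e.2).card = 0 := by
    simp only [IsPlain, Finset.sum_eq_zero_iff, Finset.card_eq_zero, Finset.filter_eq_empty_iff,
      Finset.mem_product, Prod.forall, and_imp]
    exact forall₂_congr fun v _ => ⟨fun h p q hp hq => h p hp q hq, fun h p hp q hq => h p q hp hq⟩
  rw [hplain]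
  omega

end
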